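/- Let a, b, n be positive integers with n ≥ a + b. Let A ⊆ [n] with |A| = a, let B be the b-partner of A, and let A′ be the a-partner of B. Then the pair (A′,B) is maximal, and A ≺ A′. -/

import Mathlib

open Finset

attribute [local instance] Classical.propDecidable

noncomputable section

/-- The ground set `[n] = {1, …, n}`. -/
def ground (n : ℕ) : Finset ℕ := Finset.Icc 1 n

/-- `C([n], k)`: the family of all `k`-element subsets of `[n]`. -/
def ksubsets (n k : ℕ) : Finset (Finset ℕ) := Finset.powersetCard k (ground n)

/-- Two families are cross intersecting. -/
def CrossInt (A B : Finset (Finset ℕ)) : Prop :=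
  ∀ a ∈ A, ∀ b ∈ B, (a ∩ b).Nonempty

/-- The lexicographic order `A ≺ B`:  `A ⊇ B` or `min (A ∖ B) < min (B ∖ A)`. -/
def lex (A B : Finset ℕ) : Prop :=
  B ⊆ A ∨ (A \ B).min < (B \ A).min

/-- Strict lexicographic order `A ⪵ B`. -/
def lexLT (A B : Finset ℕ) : Prop := lex A B ∧ A ≠ B

/-- `L(R, k)` over `[n]`: all `k`-subsets of `[n]` that are `≺ R`. -/
def Lset (n : ℕ) (R : Finset ℕ) (k : ℕ) : Finset (Finset ℕ) :=
  (ksubsets n k).filter fun F => lex F R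

/-- `L(r, k)`: the first `r` elements of `C([n], k)` in lexicographic order. -/
def Lnum (n r k : ℕ) : Finset (Finset ℕ) :=
  (ksubsets n k).filter fun F => ((ksubsets n k).filter fun G => lex G F).card ≤ r

/-- A family is L-initial if it equals `L(R, k)` for some `k`-set `R` (an ID of the family). -/
def LInitial (n k : ℕ) (A : Finset (Finset ℕ)) : Prop :=
  ∃ R ∈ ksubsets n k, A = Lset n R k

/-- `F` and `H` strongly intersect at their last element; `H` is the partner of `F`
(and `F` is the partner of `H`). -/
def IsPartner (F H : Finset ℕ) : Prop :=
  ∃ q, F ∩ H = {q} ∧ F ∪ H = Finset.Icc 1 q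

/-- `K` is the `k`-partner of `F` (inside `[n]`). -/
def IsKPartner (n k : ℕ) (F K : Finset ℕ) : Prop :=
  ∃ H, IsPartner F H ∧
    ((k = H.card ∧ K = H) ∨
     (H.card < k ∧ K = H ∪ Finset.Icc (n - k + H.card + 1) n) ∨
     (k < H.card ∧ K ∈ ksubsets n k ∧ lex K H ∧
        ∀ K' ∈ ksubsets n k, lex K' H → lex K' K))

/-- `ℓ(F)`: the largest `x` with `{n - x + 1, …, n} ⊆ F` (and `0` if there is none). -/
def ell (n : ℕ) (F : Finset ℕ) : ℕ :=
  ((Finset.range (n + 1)).filter fun x => Finset.Icc (n - x + 1) n ⊆ F).sup id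

/-- `F^t = {n - ℓ(F) + 1, …, n}` (which is `∅` when `ℓ(F) = 0`). -/
def tailPart (n : ℕ) (F : Finset ℕ) : Finset ℕ := Finset.Icc (n - ell n F + 1) n

/-- Maximal cross intersecting families. -/
def MaximalCross (n f g : ℕ) (F G : Finset (Finset ℕ)) : Prop :=
  F ⊆ ksubsets n f ∧ G ⊆ ksubsets n g ∧ CrossInt F G ∧
    ∀ F' G' : Finset (Finset ℕ), F ⊆ F' → F' ⊆ ksubsets n f →
      G ⊆ G' → G' ⊆ ksubsets n g → CrossInt F' G' → F = F' ∧ G = G'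

/-- The pair of sets `(F, G)` is maximal. -/
def PairMaximal (n : ℕ) (F G : Finset ℕ) : Prop :=
  MaximalCross n F.card G.card (Lset n F F.card) (Lset n G G.card)

/-- Maximal pair families. -/
def MaximalPairFamilies (n : ℕ) (A1 A2 : Finset (Finset ℕ)) : Prop :=
  A1.card = A2.card ∧ ∀ a1 ∈ A1, ∃! a2, a2 ∈ A2 ∧ PairMaximal n a1 a2

/-- `H1` is the `|H1|`-parity of `H2` (intended for `|H1| ≤ |H2|`):
`H1 ∖ H1^t = H2 ∖ H2^t` and `ℓ(H2) - ℓ(H1) = |H2| - |H1|`. -/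
def IsParity (n : ℕ) (H1 H2 : Finset ℕ) : Prop :=
  H1 \ tailPart n H1 = H2 \ tailPart n H2 ∧
    ell n H2 + H1.card = ell n H1 + H2.card

/-- The family `H1` of `h1`-sets is the `h1`-parity of the family `H2` of `h2`-sets. -/
def FamParity (n h1 h2 : ℕ) (H1 H2 : Finset (Finset ℕ)) : Prop :=
  (∀ A ∈ H1, ∃ B ∈ ksubsets n h2, IsParity n A B ∧ B ∈ H2) ∧
  (∀ B ∈ H2, ∀ A ∈ ksubsets n h1, IsParity n A B → A ∈ H1)

/-- An `(n, k 0, …, k (t-1))`-cross intersecting system:  non-empty pairwise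
cross intersecting families `F i ⊆ C([n], k i)`. -/
def IsCIS (n : ℕ) {t : ℕ} (k : Fin t → ℕ) (F : Fin t → Finset (Finset ℕ)) : Prop :=
  (∀ i, F i ⊆ ksubsets n (k i)) ∧ (∀ i, (F i).Nonempty) ∧
    ∀ i j : Fin t, i < j → CrossInt (F i) (F j)

/-- An extremal cross intersecting system. -/
def Extremal (n : ℕ) {t : ℕ} (k : Fin t → ℕ) (F : Fin t → Finset (Finset ℕ)) : Prop :=
  IsCIS n k F ∧ ∀ G : Fin t → Finset (Finset ℕ), IsCIS n k G →
    ∑ i, (G i).card ≤ ∑ i, (F i).card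

/-- Two systems of families are isomorphic via a permutation of the ground set `[n]`. -/
def IsoSystems (n : ℕ) {t : ℕ} (F G : Fin t → Finset (Finset ℕ)) : Prop :=
  ∃ σ : Equiv.Perm ℕ, (∀ x ∈ ground n, σ x ∈ ground n) ∧
    ∀ i, F i = (G i).image fun s => s.image ⇑σ

/-- The family `ℛ₂`. -/
def R2fam (n k2 kt : ℕ) : Finset (Finset ℕ) :=
  (ksubsets n k2).filter fun R =>
    lex (insert 1 (Finset.Icc (n - k2 + 2) n)) R ∧
    lex R (insert kt (Finset.Icc (n - k2 + 2) n))

/-- The family `ℱ₂,₃`. -/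
def F23 (n k2 k3 kt : ℕ) : Finset (Finset ℕ) :=
  (R2fam n k2 kt).filter fun A => ∃ B ∈ ksubsets n k3, PairMaximal n A B

theorem lex_iff {A B : Finset ℕ} :
    lex A B ↔ B ⊆ A ∨ ∃ y ∈ A, y ∉ B ∧ ∀ x ∈ B, x < y → x ∈ A := by
  unfold lex
  constructor
  · rintro (h | h)
    · exact Or.inl h
    · obtain ⟨y, hy⟩ := WithTop.ne_top_iff_exists.1 (ne_top_of_lt h)
      have hmem := Finset.mem_of_min hy.symm
      rw [Finset.mem_sdiff] at hmem
      refine Or.inr ⟨y, hmem.1, hmem.2, fun x hxB hxy => ?_⟩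
      by_contra hxA
      have hle := Finset.min_le (Finset.mem_sdiff.2 ⟨hxB, hxA⟩)
      rw [← hy] at h
      exact absurd (WithTop.coe_lt_coe.1 (h.trans_le hle)) (by omega)
  · rintro (h | ⟨y, hyA, hyB, hy⟩)
    · exact Or.inl h
    · by_cases hBA : B ⊆ A
      · exact Or.inl hBA
      right
      have hne : (B \ A).Nonempty := Finset.sdiff_nonempty.2 hBA
      refine (Finset.min_le (Finset.mem_sdiff.2 ⟨hyA, hyB⟩)).trans_lt ?_
      obtain ⟨w, hw⟩ := Finset.min_of_nonempty hne
      have hmem := Finset.mem_sdiff.1 (Finset.mem_of_min hw)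
      rw [hw]
      refine WithTop.coe_lt_coe.2 ?_
      rcases lt_trichotomy w y with h | h | h
      · exact absurd (hy w hmem.1 h) hmem.2
      · exact absurd (h ▸ hmem.1) hyB
      · exact h

theorem lex_trans {A B C : Finset ℕ} (hAB : lex A B) (hBC : lex B C) : lex A C := by
  rw [lex_iff] at *
  rcases hAB with hAB | ⟨y, hyA, hyB, hy⟩ <;> rcases hBC with hBC | ⟨z, hzB, hzC, hz⟩
  · exact Or.inl (hBC.trans hAB)
  · exact Or.inr ⟨z, hAB hzB, hzC, fun x hx hxz => hAB (hz x hx hxz)⟩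
  · exact Or.inr ⟨y, hyA, fun h => hyB (hBC h), fun x hx hxy => hy x (hBC hx) hxy⟩
  · right
    rcases lt_trichotomy y z with h | h | h
    · exact ⟨y, hyA, fun hyC => hyB (hz y hyC h),
        fun x hx hxy => hy x (hz x hx (hxy.trans h)) hxy⟩
    · exact absurd (h ▸ hzB) hyB
    · exact ⟨z, hy z hzB h, hzC, fun x hx hxz => hy x (hz x hx hxz) (hxz.trans h)⟩

theorem exists_of_not_lex {A B : Finset ℕ} (h : ¬ lex A B) :
    ∃ x ∈ B, x ∉ A ∧ ∀ z ∈ A, z < x → z ∈ B := by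
  rw [lex_iff, not_or] at h
  obtain ⟨hBA, hno⟩ := h
  have hne : (B \ A).Nonempty := Finset.sdiff_nonempty.2 hBA
  have hmem := Finset.mem_sdiff.1 (Finset.min'_mem _ hne)
  refine ⟨_, hmem.1, hmem.2, fun z hzA hz => ?_⟩
  by_contra hzB
  refine hno ⟨z, hzA, hzB, fun w hwB hwz => ?_⟩
  by_contra hwA
  have := Finset.min'_le _ w (Finset.mem_sdiff.2 ⟨hwB, hwA⟩)
  omega

theorem mem_ksubsets {n k : ℕ} {F : Finset ℕ} :
    F ∈ ksubsets n k ↔ F ⊆ ground n ∧ F.card = k :=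
  Finset.mem_powersetCard

theorem mem_Lset {n k : ℕ} {R F : Finset ℕ} :
    F ∈ Lset n R k ↔ F ∈ ksubsets n k ∧ lex F R :=
  Finset.mem_filter

/-- Sets of positive integers preceding the two members of a partner pair intersect. -/
theorem IsPartner.inter_nonempty {A H F G : Finset ℕ} (h : IsPartner A H)
    (hF0 : ∀ x ∈ F, 1 ≤ x) (hG0 : ∀ x ∈ G, 1 ≤ x) (hF : lex F A) (hG : lex G H) :
    (F ∩ G).Nonempty := by
  obtain ⟨q, hq, hu⟩ := h
  have hqm : q ∈ A ∧ q ∈ H := by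
    rw [← Finset.mem_inter, hq]; exact Finset.mem_singleton_self q
  have hu' : ∀ x, 1 ≤ x → x ≤ q → x ∈ A ∨ x ∈ H := fun x h1 h2 => by
    rw [← Finset.mem_union, hu]; exact Finset.mem_Icc.2 ⟨h1, h2⟩
  rw [lex_iff] at hF hG
  by_contra hne
  have hd : ∀ x ∈ F, x ∉ G := fun x hx hx' => hne ⟨x, Finset.mem_inter.2 ⟨hx, hx'⟩⟩
  rcases hF with hF | ⟨y, hyF, hyA, hy⟩ <;> rcases hG with hG | ⟨z, hzG, hzH, hz⟩
  · exact hd q (hF hqm.1) (hG hqm.2)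
  · have := hu' z (hG0 z hzG)
    grind
  · have := hu' y (hF0 y hyF)
    grind
  · have := hu' z (hG0 z hzG)
    have := hu' y (hF0 y hyF)
    grind

/-- If `G` does not precede the partner of `A`, then some set preceding `A` is disjoint
from `G`. -/
theorem IsPartner.exists_disjoint {n b : ℕ} {A H G : Finset ℕ} (h : IsPartner A H)
    (hA : A ⊆ ground n) (hab : A.card + b ≤ n) (hG : G ∈ ksubsets n b) (hGH : ¬ lex G H) :
    ∃ F ∈ ksubsets n A.card, lex F A ∧ Disjoint F G := by
  obtain ⟨q, hq, hu⟩ := h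
  have hqm : q ∈ A ∧ q ∈ H := by
    rw [← Finset.mem_inter, hq]; exact Finset.mem_singleton_self q
  have hi : ∀ x ∈ A, x ∈ H → x = q := fun x h1 h2 => by
    rw [← Finset.mem_singleton, ← hq]; exact Finset.mem_inter.2 ⟨h1, h2⟩
  have hle : ∀ x, x ∈ A ∨ x ∈ H → 1 ≤ x ∧ x ≤ q := fun x hx => by
    rw [← Finset.mem_union, hu] at hx; exact Finset.mem_Icc.1 hx
  have hqn : q ≤ n := (Finset.mem_Icc.1 (hA hqm.1)).2
  obtain ⟨hGn, hGb⟩ := mem_ksubsets.1 hG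
  obtain ⟨x, hxH, hxG, hx⟩ := exists_of_not_lex hGH
  have hxq := hle x (Or.inr hxH)
  set P : Finset ℕ := insert x (A.filter (· < x)) with hP
  have hsub : P ⊆ ground n \ G := by
    intro w hw
    rw [hP, Finset.mem_insert, Finset.mem_filter] at hw
    rw [Finset.mem_sdiff]
    rcases hw with rfl | ⟨hwA, hwx⟩
    · exact ⟨Finset.mem_Icc.2 ⟨hxq.1, hxq.2.trans hqn⟩, hxG⟩
    · refine ⟨hA hwA, fun hwG => ?_⟩
      have := hi w hwA (hx w hwG hwx)
      omega
  have hcard : P.card ≤ A.card := by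
    refine (Finset.card_insert_le _ _).trans (Finset.card_lt_card ?_)
    exact Finset.filter_ssubset.2 ⟨q, hqm.1, by omega⟩
  have hroom : A.card ≤ (ground n \ G).card := by
    rw [Finset.card_sdiff_of_subset hGn, hGb, ground, Nat.card_Icc]
    omega
  obtain ⟨F, hPF, hFG, hFc⟩ := Finset.exists_subsuperset_card_eq hsub hcard hroom
  have hxF : x ∈ F := hPF (Finset.mem_insert_self _ _)
  have hlt : ∀ w ∈ A, w < x → w ∈ F := fun w hw hwx =>
    hPF (Finset.mem_insert_of_mem (Finset.mem_filter.2 ⟨hw, hwx⟩))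
  refine ⟨F, mem_ksubsets.2 ⟨hFG.trans Finset.sdiff_subset, hFc⟩, lex_iff.2 ?_,
    Finset.disjoint_of_subset_left hFG Finset.sdiff_disjoint⟩
  by_cases hxA : x ∈ A
  · left
    intro w hw
    have h1 := hi x hxA hxH
    have h2 := hle w (Or.inl hw)
    rcases lt_or_eq_of_le h2.2 with h3 | h3
    · exact hlt w hw (by omega)
    · rwa [h3, ← h1]
  · exact Or.inr ⟨x, hxF, hxA, hlt⟩

theorem IsPartner.card_add_card {A H : Finset ℕ} (h : IsPartner A H) :
    ∃ q, A ⊆ Finset.Icc 1 q ∧ H ⊆ Finset.Icc 1 q ∧ q ∈ A ∧ A.card + H.card = q + 1 := by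
  obtain ⟨q, hq, hu⟩ := h
  refine ⟨q, hu ▸ Finset.subset_union_left, hu ▸ Finset.subset_union_right, ?_, ?_⟩
  · exact (Finset.mem_inter.1 (hq ▸ Finset.mem_singleton_self q)).1
  · rw [← Finset.card_union_add_card_inter, hq, hu]
    simp

/-- The sets `G` preceding the partner `H` of `A` precede every `b`-partner of `A`, and
conversely the `b`-partner is itself a `b`-set preceding `H`. -/
theorem IsKPartner.exists_partner {n b : ℕ} {A B : Finset ℕ} (hA : A ⊆ ground n)
    (hab : A.card + b ≤ n) (hB : IsKPartner n b A B) :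
    ∃ H, IsPartner A H ∧ B ∈ ksubsets n b ∧ lex B H ∧
      ∀ G ∈ ksubsets n b, lex G H → lex G B := by
  obtain ⟨H, hAH, hc⟩ := hB
  refine ⟨H, hAH, ?_⟩
  obtain ⟨q, -, hHq, hqA, hcard⟩ := hAH.card_add_card
  have hqn : q ≤ n := (Finset.mem_Icc.1 (hA hqA)).2
  have hHn : H ⊆ ground n := hHq.trans (Finset.Icc_subset_Icc_right hqn)
  rcases hc with ⟨rfl, rfl⟩ | ⟨hlt, rfl⟩ | ⟨-, h⟩
  · exact ⟨mem_ksubsets.2 ⟨hHn, rfl⟩, lex_iff.2 (Or.inl subset_rfl), fun _ _ h => h⟩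
  · have hdisj : Disjoint H (Finset.Icc (n - b + H.card + 1) n) := by
      rw [Finset.disjoint_left]
      intro x hx hx'
      have h1 := Finset.mem_Icc.1 (hHq hx)
      have h2 := Finset.mem_Icc.1 hx'
      omega
    have hBc : (H ∪ Finset.Icc (n - b + H.card + 1) n).card = b := by
      rw [Finset.card_union_of_disjoint hdisj, Nat.card_Icc]
      omega
    refine ⟨mem_ksubsets.2 ⟨Finset.union_subset hHn (Finset.Icc_subset_Icc_left (by omega)), hBc⟩,
      lex_iff.2 (Or.inl Finset.subset_union_left), fun G hG hGH => ?_⟩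
    obtain ⟨hGn, hGb⟩ := mem_ksubsets.1 hG
    have key : H ⊆ G → lex G (H ∪ Finset.Icc (n - b + H.card + 1) n) := by
      intro hHG
      by_cases hGB : G ⊆ H ∪ Finset.Icc (n - b + H.card + 1) n
      · exact lex_iff.2 (Or.inl (Finset.eq_of_subset_of_card_le hGB (by omega)).ge)
      · obtain ⟨v, hvG, hvB⟩ := Finset.not_subset.1 hGB
        refine lex_iff.2 (Or.inr ⟨v, hvG, hvB, fun x hx hxv => ?_⟩)
        have h1 := Finset.mem_Icc.1 (hGn hvG)
        rcases Finset.mem_union.1 hx with hx | hx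
        · exact hHG hx
        · have h2 := Finset.mem_Icc.1 hx
          exact absurd (Finset.mem_union_right _ (Finset.mem_Icc.2 ⟨by omega, h1.2⟩)) hvB
    rcases lex_iff.1 hGH with h | ⟨z, hzG, hzH, hz⟩
    · exact key h
    · by_cases hzt : z ≤ n - b + H.card
      · refine lex_iff.2 (Or.inr ⟨z, hzG, fun h => ?_, fun x hx hxz => ?_⟩)
        · rcases Finset.mem_union.1 h with h | h
          · exact hzH h
          · have := Finset.mem_Icc.1 h
            omega
        · rcases Finset.mem_union.1 hx with h | h
          · exact hz x h hxz
          · have := Finset.mem_Icc.1 h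
            omega
      · refine key fun x hx => hz x hx ?_
        have := Finset.mem_Icc.1 (hHq hx)
        omega
  · exact h

/-- The `b`-partner `B` of `A` is the last `b`-set such that `L(A, |A|)` and `L(B, b)` are
cross intersecting. -/
theorem IsKPartner.crossInt_and_last {n b : ℕ} {A B : Finset ℕ} (hA : A ⊆ ground n)
    (hab : A.card + b ≤ n) (hB : IsKPartner n b A B) :
    B ∈ ksubsets n b ∧ CrossInt (Lset n A A.card) (Lset n B b) ∧
      ∀ G ∈ ksubsets n b, (∀ F ∈ Lset n A A.card, (F ∩ G).Nonempty) → lex G B := by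
  obtain ⟨H, hAH, hBk, hBH, hlast⟩ := hB.exists_partner hA hab
  have hpos : ∀ {k : ℕ} {F : Finset ℕ}, F ∈ ksubsets n k → ∀ x ∈ F, 1 ≤ x :=
    fun hF x hx => (Finset.mem_Icc.1 ((mem_ksubsets.1 hF).1 hx)).1
  refine ⟨hBk, fun F hF G hG => ?_, fun G hG hint => hlast G hG ?_⟩
  · rw [mem_Lset] at hF hG
    exact hAH.inter_nonempty (hpos hF.1) (hpos hG.1) hF.2 (lex_trans hG.2 hBH)
  · by_contra hGH
    obtain ⟨F, hF, hFA, hd⟩ := hAH.exists_disjoint hA hab hG hGH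
    exact Finset.not_disjoint_iff_nonempty_inter.2 (hint F (mem_Lset.2 ⟨hF, hFA⟩)) hd

/-- if `B` is the `b`-partner of `A` and `A'` is the `a`-partner of `B`,
then `(A', B)` is maximal and `A ≺ A'`. -/
theorem kpartner_roundtrip_maximal (a b n : ℕ) (ha : 0 < a) (hb : 0 < b)
    (hab : a + b ≤ n) (A B A' : Finset ℕ) (hA : A ⊆ ground n) (hAcard : A.card = a)
    (hB : IsKPartner n b A B) (hA' : IsKPartner n a B A') :
    PairMaximal n A' B ∧ lex A A' := by
  subst hAcard
  obtain ⟨hBk, hcross, hBlast⟩ := hB.crossInt_and_last hA hab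
  obtain ⟨hBn, rfl⟩ := mem_ksubsets.1 hBk
  obtain ⟨hAk, hcross', hAlast⟩ := hA'.crossInt_and_last hBn (by omega)
  have hAL : A ∈ Lset n A A.card :=
    mem_Lset.2 ⟨mem_ksubsets.2 ⟨hA, rfl⟩, lex_iff.2 (Or.inl subset_rfl)⟩
  have hAA' : lex A A' := hAlast A (mem_ksubsets.2 ⟨hA, rfl⟩) fun G hG => by
    rw [Finset.inter_comm]
    exact hcross A hAL G hG
  refine ⟨?_, hAA'⟩
  unfold PairMaximal
  rw [(mem_ksubsets.1 hAk).2]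
  refine ⟨Finset.filter_subset _ _, Finset.filter_subset _ _, fun F hF G hG => ?_,
    fun F' G' hF hF' hG hG' hFG => ⟨hF.antisymm fun F hFm => ?_, hG.antisymm fun G hGm => ?_⟩⟩
  · rw [Finset.inter_comm]
    exact hcross' G hG F hF
  · refine mem_Lset.2 ⟨hF' hFm, hAlast F (hF' hFm) fun G hGm => ?_⟩
    rw [Finset.inter_comm]
    exact hFG F hFm G (hG hGm)
  · refine mem_Lset.2 ⟨hG' hGm, hBlast G (hG' hGm) fun F hFm => hFG F (hF ?_) G hGm⟩
    rw [mem_Lset] at hFm ⊢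
    exact ⟨hFm.1, lex_trans hFm.2 hAA'⟩
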